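/- Let 1 ≤ p < ∞ and let φ : ℝⁿ × (0,∞) → (0,∞) satisfy the doubling condition (D). Then there is a constant C, depending only on n and the doubling constant of φ, such that for every f with ‖f‖_{𝓛_{p,φ}} < ∞, every x ∈ ℝⁿ and all 0 < r₁ < r₂, one has |f_{B(x,r₁)} − f_{B(x,r₂)}| ≤ C (∫_{r₁}^{2r₂} φ(x,t)/t dt) ‖f‖_{𝓛_{p,φ}}. -/

import Mathlib

open MeasureTheory Metric Filter
open scoped ENNReal NNReal

noncomputable section

/-- Average of `f` over the ball `B(x,r)`. -/
def ballAvg {n : ℕ} (f : EuclideanSpace ℝ (Fin n) → ℝ) (x : EuclideanSpace ℝ (Fin n))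
    (r : ℝ) : ℝ :=
  (volume (ball x r)).toReal⁻¹ * ∫ y in ball x r, f y

/-- Campanato seminorm with variable growth function `φ`. -/
def campSemi {n : ℕ} (p : ℝ) (φ : EuclideanSpace ℝ (Fin n) → ℝ → ℝ)
    (f : EuclideanSpace ℝ (Fin n) → ℝ) : ℝ≥0∞ :=
  ⨆ (x : EuclideanSpace ℝ (Fin n)) (r : ℝ) (_ : 0 < r),
    ENNReal.ofReal ((φ x r)⁻¹ *
      ((volume (ball x r)).toReal⁻¹ * ∫ y in ball x r, |f y - ballAvg f x r| ^ p) ^ (1 / p))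

/-- Campanato norm: seminorm plus `|f_{B(0,1)}|`. -/
def campNorm {n : ℕ} (p : ℝ) (φ : EuclideanSpace ℝ (Fin n) → ℝ → ℝ)
    (f : EuclideanSpace ℝ (Fin n) → ℝ) : ℝ≥0∞ :=
  campSemi p φ f + ENNReal.ofReal |ballAvg f 0 1|

/-- Morrey norm with variable growth function `φ`. -/
def morreyNorm {n : ℕ} (p : ℝ) (φ : EuclideanSpace ℝ (Fin n) → ℝ → ℝ)
    (f : EuclideanSpace ℝ (Fin n) → ℝ) : ℝ≥0∞ :=
  ⨆ (x : EuclideanSpace ℝ (Fin n)) (r : ℝ) (_ : 0 < r),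
    ENNReal.ofReal ((φ x r)⁻¹ *
      ((volume (ball x r)).toReal⁻¹ * ∫ y in ball x r, |f y| ^ p) ^ (1 / p))

/-- Hölder seminorm with variable growth function `φ`. -/
def holderSemi {n : ℕ} (φ : EuclideanSpace ℝ (Fin n) → ℝ → ℝ)
    (f : EuclideanSpace ℝ (Fin n) → ℝ) : ℝ≥0∞ :=
  ⨆ (x : EuclideanSpace ℝ (Fin n)) (y : EuclideanSpace ℝ (Fin n)) (_ : x ≠ y),
    ENNReal.ofReal (2 * |f x - f y| / (φ x (dist x y) + φ y (dist x y)))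

/-- The doubling condition (D) with constant `A`. -/
def DoublingWith {n : ℕ} (A : ℝ) (φ : EuclideanSpace ℝ (Fin n) → ℝ → ℝ) : Prop :=
  ∀ (x : EuclideanSpace ℝ (Fin n)) (r s : ℝ), 0 < r → 0 < s →
    1 / 2 ≤ s / r → s / r ≤ 2 → A⁻¹ ≤ φ x s / φ x r ∧ φ x s / φ x r ≤ A

/-- The doubling condition (D). -/
def Doubling {n : ℕ} (φ : EuclideanSpace ℝ (Fin n) → ℝ → ℝ) : Prop :=
  ∃ A > 0, DoublingWith A φ

/-- The nearness condition (N). -/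
def Nearness {n : ℕ} (φ : EuclideanSpace ℝ (Fin n) → ℝ → ℝ) : Prop :=
  ∃ A > 0, ∀ (x y : EuclideanSpace ℝ (Fin n)) (r : ℝ), 0 < r → dist x y ≤ r →
    A⁻¹ ≤ φ x r / φ y r ∧ φ x r / φ y r ≤ A

/-- The almost increasing condition (I). -/
def AlmostIncreasing {n : ℕ} (φ : EuclideanSpace ℝ (Fin n) → ℝ → ℝ) : Prop :=
  ∃ A > 0, ∀ (x : EuclideanSpace ℝ (Fin n)) (r s : ℝ), 0 < r → r < s → φ x r ≤ A * φ x s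

/-- Positivity of the variable growth function. -/
def GrowthPos {n : ℕ} (φ : EuclideanSpace ℝ (Fin n) → ℝ → ℝ) : Prop :=
  ∀ (x : EuclideanSpace ℝ (Fin n)) (r : ℝ), 0 < r → 0 < φ x r

/-- `f ∈ L^p_loc(ℝⁿ)` (in particular `f ∈ L¹_loc`). -/
def MemLpLoc {n : ℕ} (p : ℝ) (f : EuclideanSpace ℝ (Fin n) → ℝ) : Prop :=
  LocallyIntegrable f volume ∧
    ∀ (x : EuclideanSpace ℝ (Fin n)) (r : ℝ), 0 < r →
      IntegrableOn (fun y => |f y| ^ p) (ball x r) volume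


lemma aux_vol {n : ℕ} (x : EuclideanSpace ℝ (Fin n)) {s r : ℝ} (hr2 : r ≤ 2 * s) :
    (volume (ball x r)).toReal ≤ 2 ^ n * (volume (ball x s)).toReal := by
  have h1 : volume (ball x r) ≤ volume (ball x (2 * s)) := measure_mono (ball_subset_ball hr2)
  rw [Measure.addHaar_ball_mul_of_pos volume x (by norm_num) s,
    ← Measure.addHaar_ball_center volume x s, finrank_euclideanSpace_fin] at h1
  have h2 := ENNReal.toReal_mono
    (ENNReal.mul_ne_top ENNReal.ofReal_ne_top measure_ball_lt_top.ne) h1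
  rwa [ENNReal.toReal_mul, ENNReal.toReal_ofReal (by positivity)] at h2

lemma aux_pos {n : ℕ} (x : EuclideanSpace ℝ (Fin n)) {s : ℝ} (hs : 0 < s) :
    0 < (volume (ball x s)).toReal :=
  ENNReal.toReal_pos (measure_ball_pos volume x hs).ne' measure_ball_lt_top.ne

lemma aux_int {n : ℕ} {p : ℝ} {f : EuclideanSpace ℝ (Fin n) → ℝ} (hf : MemLpLoc p f)
    (x : EuclideanSpace ℝ (Fin n)) (r : ℝ) : IntegrableOn f (ball x r) :=
  (hf.1.integrableOn_isCompact (isCompact_closedBall x r)).mono_set ball_subset_closedBall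

/-- Jensen. -/
lemma aux_jensen {n : ℕ} {p : ℝ} (hp : 1 ≤ p) {f : EuclideanSpace ℝ (Fin n) → ℝ}
    (hf : MemLpLoc p f) (x : EuclideanSpace ℝ (Fin n)) {r : ℝ} (hr : 0 < r) (c : ℝ) :
    (volume (ball x r)).toReal⁻¹ * ∫ y in ball x r, |f y - c| ≤
      ((volume (ball x r)).toReal⁻¹ * ∫ y in ball x r, |f y - c| ^ p) ^ (1 / p) := by
  have hp0 : 0 < p := by linarith
  have hV := aux_pos x hr
  have hfin : IsFiniteMeasure (volume.restrict (ball x r)) :=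
    ⟨by simpa using measure_ball_lt_top⟩
  have hi := aux_int hf x r
  have h0 : ENNReal.ofReal p ≠ 0 := by simpa using hp0
  have hM : MemLp f (ENNReal.ofReal p) (volume.restrict (ball x r)) := by
    rw [← integrable_norm_rpow_iff hi.aestronglyMeasurable h0 ENNReal.ofReal_ne_top,
      ENNReal.toReal_ofReal hp0.le]
    exact hf.2 x r hr
  have hM2 : MemLp (fun y => f y - c) (ENNReal.ofReal p) (volume.restrict (ball x r)) :=
    hM.sub (memLp_const c)
  have hI : IntegrableOn (fun y => |f y - c| ^ p) (ball x r) := by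
    have := (integrable_norm_rpow_iff hM2.1 h0 ENNReal.ofReal_ne_top).2 hM2
    rw [ENNReal.toReal_ofReal hp0.le] at this
    exact this
  have hI1 : IntegrableOn (fun y => |f y - c|) (ball x r) :=
    (hi.sub (integrable_const c)).abs
  have hJ := ConvexOn.map_set_average_le (μ := volume) (t := ball x r)
    (f := fun y => |f y - c|) (convexOn_rpow hp)
    (Real.continuous_rpow_const hp0.le).continuousOn isClosed_Ici
    (measure_ball_pos volume x hr).ne' measure_ball_lt_top.ne
    (ae_of_all _ fun y => Set.mem_Ici.2 (abs_nonneg _)) hI1 hI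
  simp only [setAverage_eq, smul_eq_mul, Measure.real] at hJ
  have hn : 0 ≤ (volume (ball x r)).toReal⁻¹ * ∫ y in ball x r, |f y - c| :=
    mul_nonneg (by positivity) (integral_nonneg fun y => abs_nonneg _)
  calc _ = (((volume (ball x r)).toReal⁻¹ * ∫ y in ball x r, |f y - c|) ^ p) ^ (1 / p) := by
        rw [← Real.rpow_mul hn, mul_one_div_cancel hp0.ne', Real.rpow_one]
    _ ≤ _ := Real.rpow_le_rpow (by positivity) hJ (by positivity)

lemma aux_osc {n : ℕ} {p : ℝ} (hp : 1 ≤ p) {φ : EuclideanSpace ℝ (Fin n) → ℝ → ℝ}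
    (hφ : GrowthPos φ) {f : EuclideanSpace ℝ (Fin n) → ℝ}
    (hf : MemLpLoc p f) (hfin : campSemi p φ f < ⊤) (x : EuclideanSpace ℝ (Fin n)) {r : ℝ}
    (hr : 0 < r) :
    (volume (ball x r)).toReal⁻¹ * ∫ y in ball x r, |f y - ballAvg f x r| ≤
      φ x r * (campSemi p φ f).toReal := by
  refine (aux_jensen hp hf x hr _).trans ?_
  have h1 : ENNReal.ofReal ((φ x r)⁻¹ *
      ((volume (ball x r)).toReal⁻¹ * ∫ y in ball x r, |f y - ballAvg f x r| ^ p) ^ (1 / p))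
      ≤ campSemi p φ f := by
    unfold campSemi
    exact le_iSup_of_le x (le_iSup_of_le r (le_iSup_of_le hr le_rfl))
  have h2 := (ENNReal.ofReal_le_iff_le_toReal hfin.ne).1 h1
  rwa [inv_mul_le_iff₀ (hφ x r hr)] at h2

lemma aux_step {n : ℕ} {p : ℝ} (hp : 1 ≤ p) {φ : EuclideanSpace ℝ (Fin n) → ℝ → ℝ}
    (hφ : GrowthPos φ) {f : EuclideanSpace ℝ (Fin n) → ℝ}
    (hf : MemLpLoc p f) (hfin : campSemi p φ f < ⊤) (x : EuclideanSpace ℝ (Fin n)) {s r : ℝ}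
    (hs : 0 < s) (hsr : s ≤ r) (hr2 : r ≤ 2 * s) :
    |ballAvg f x s - ballAvg f x r| ≤ 2 ^ n * (φ x r * (campSemi p φ f).toReal) := by
  have hr : 0 < r := hs.trans_le hsr
  have hVs := aux_pos x hs
  have hVr := aux_pos x hr
  have hv := aux_vol x hr2
  set c := ballAvg f x r with hc
  have hfinm : ∀ t, IsFiniteMeasure (volume.restrict (ball x t)) := fun t =>
    ⟨by simpa using measure_ball_lt_top⟩
  have h1 : ballAvg f x s - c = (volume (ball x s)).toReal⁻¹ * ∫ y in ball x s, (f y - c) := by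
    rw [integral_sub (aux_int hf x s) (integrable_const c), setIntegral_const]
    unfold ballAvg
    simp only [smul_eq_mul, Measure.real]
    field_simp
  have hI1 : IntegrableOn (fun y => |f y - c|) (ball x r) :=
    ((aux_int hf x r).sub (integrable_const c)).abs
  have h0 : 0 ≤ ∫ y in ball x r, |f y - c| := integral_nonneg fun y => abs_nonneg _
  have hvi : (volume (ball x s)).toReal⁻¹ ≤ 2 ^ n * (volume (ball x r)).toReal⁻¹ := by
    rw [← div_eq_mul_inv, inv_le_comm₀ hVs (by positivity), inv_div, div_le_iff₀ (by positivity)]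
    linarith
  calc |ballAvg f x s - c| = (volume (ball x s)).toReal⁻¹ * |∫ y in ball x s, (f y - c)| := by
        rw [h1, abs_mul, abs_of_pos (inv_pos.2 hVs)]
    _ ≤ (volume (ball x s)).toReal⁻¹ * ∫ y in ball x s, |f y - c| := by
        gcongr
        exact abs_integral_le_integral_abs
    _ ≤ (volume (ball x s)).toReal⁻¹ * ∫ y in ball x r, |f y - c| := by
        gcongr ?_ * ?_
        exact setIntegral_mono_set hI1 (ae_of_all _ fun y => abs_nonneg _)
          (ball_subset_ball hsr).eventuallyLE
    _ ≤ 2 ^ n * (volume (ball x r)).toReal⁻¹ * ∫ y in ball x r, |f y - c| := by gcongr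
    _ ≤ _ := by
        rw [mul_assoc]
        exact mul_le_mul_of_nonneg_left (aux_osc hp hφ hf hfin x hr) (by positivity)

lemma aux_dbl {n : ℕ} {A : ℝ} {φ : EuclideanSpace ℝ (Fin n) → ℝ → ℝ}
    (hφ : GrowthPos φ) (hD : DoublingWith A φ) (x : EuclideanSpace ℝ (Fin n)) {s r : ℝ}
    (hs : 0 < s) (hr : 0 < r) (h1 : s ≤ 2 * r) (h2 : r ≤ 2 * s) : φ x s ≤ A * φ x r := by
  have := (hD x r s hr hs (by rw [le_div_iff₀ hr]; linarith) (by rw [div_le_iff₀ hr]; linarith)).2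
  rwa [div_le_iff₀ (hφ x r hr)] at this

lemma aux_intble {n : ℕ} {A : ℝ} (hA : 0 < A) {φ : EuclideanSpace ℝ (Fin n) → ℝ → ℝ}
    (hφ : GrowthPos φ) (hD : DoublingWith A φ) (x : EuclideanSpace ℝ (Fin n))
    (hm : Measurable fun t => φ x t) {a : ℝ} (ha : 0 < a) :
    IntegrableOn (fun t => φ x t / t) (Set.Ioc a (2 * a)) := by
  refine Measure.integrableOn_of_bounded (M := A * φ x a / a) (by simp)
    (hm.div measurable_id).aestronglyMeasurable ?_
  refine (ae_restrict_mem measurableSet_Ioc).mono fun t ht => ?_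
  have ht0 : 0 < t := ha.trans ht.1
  have := hφ x t ht0
  have := hφ x a ha
  rw [Real.norm_of_nonneg (by positivity)]
  gcongr
  · exact aux_dbl hφ hD x ht0 ha ht.2 (by linarith [ht.1])
  · exact ht.1.le

lemma aux_low {n : ℕ} {A : ℝ} (hA : 0 < A) {φ : EuclideanSpace ℝ (Fin n) → ℝ → ℝ}
    (hφ : GrowthPos φ) (hD : DoublingWith A φ) (x : EuclideanSpace ℝ (Fin n))
    (hm : Measurable fun t => φ x t) {a b : ℝ} (ha : 0 < a) (hab : a ≤ b) (hb : b ≤ 2 * a) :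
    φ x b ≤ 2 * A * ∫ t in Set.Ioc a (2 * a), φ x t / t := by
  have hb0 : 0 < b := ha.trans_le hab
  have h : ∫ t in Set.Ioc a (2 * a), φ x b / (A * (2 * a)) ≤
      ∫ t in Set.Ioc a (2 * a), φ x t / t := by
    refine setIntegral_mono_on (by simp) (aux_intble hA hφ hD x hm ha)
      measurableSet_Ioc fun t ht => ?_
    have ht0 : 0 < t := ha.trans ht.1
    have h1 := hφ x t ht0
    have h2 := hφ x b hb0
    have h3 := aux_dbl hφ hD x hb0 ht0 (by linarith [ht.1]) (by linarith [ht.2])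
    rw [← div_div]
    have h4 : φ x b / A ≤ φ x t := by rw [div_le_iff₀ hA]; linarith
    gcongr
    exact ht.2
  rw [setIntegral_const] at h
  have e : (volume.real (Set.Ioc a (2 * a))) • (φ x b / (A * (2 * a))) = φ x b / (2 * A) := by
    rw [Real.volume_real_Ioc_of_le (by linarith), smul_eq_mul]
    field_simp
    ring
  rw [e, div_le_iff₀ (by positivity)] at h
  linarith

lemma aux_main {n : ℕ} {A : ℝ} (hA : 0 < A) {p : ℝ} (hp : 1 ≤ p)
    {φ : EuclideanSpace ℝ (Fin n) → ℝ → ℝ}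
    (hφ : GrowthPos φ) (hD : DoublingWith A φ) {f : EuclideanSpace ℝ (Fin n) → ℝ}
    (hf : MemLpLoc p f) (hfin : campSemi p φ f < ⊤) (x : EuclideanSpace ℝ (Fin n))
    (hm : Measurable fun t => φ x t) (r₂ : ℝ) (k : ℕ) :
    ∀ r₁ : ℝ, 0 < r₁ → r₁ ≤ r₂ → r₂ ≤ 2 ^ k * r₁ →
      IntegrableOn (fun t => φ x t / t) (Set.Ioc r₁ (2 * r₂)) ∧
      |ballAvg f x r₁ - ballAvg f x r₂| ≤
        2 ^ n * (2 * A) * (∫ t in Set.Ioc r₁ (2 * r₂), φ x t / t) * (campSemi p φ f).toReal := by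
  set N := (campSemi p φ f).toReal with hN
  have hN0 : 0 ≤ N := ENNReal.toReal_nonneg
  induction k with
  | zero =>
    intro r₁ h0 h1 h2
    have : r₁ = r₂ := by linarith
    subst this
    refine ⟨aux_intble hA hφ hD x hm h0, ?_⟩
    rw [sub_self, abs_zero]
    have := aux_low hA hφ hD x hm h0 le_rfl (by linarith)
    have h3 := hφ x _ h0
    have : 0 ≤ ∫ t in Set.Ioc r₁ (2 * r₁), φ x t / t := by
      refine setIntegral_nonneg measurableSet_Ioc fun t ht => ?_
      have ht0 : 0 < t := h0.trans ht.1
      have := hφ x t ht0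
      positivity
    positivity
  | succ k ih =>
    intro r₁ h0 h1 h2
    have hi1 := aux_intble hA hφ hD x hm h0
    have hr2 : 0 < r₂ := h0.trans_le h1
    rcases le_total r₂ (2 * r₁) with h | h
    · have hi2 := aux_intble hA hφ hD x hm hr2
      have hI : IntegrableOn (fun t => φ x t / t) (Set.Ioc r₁ (2 * r₂)) := by
        rw [← Set.Ioc_union_Ioc_eq_Ioc h1 (by linarith : r₂ ≤ 2 * r₂)]
        exact (hi1.mono_set (Set.Ioc_subset_Ioc_right h)).union hi2
      refine ⟨hI, ?_⟩
      have hs := aux_step hp hφ hf hfin x h0 h1 h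
      have hl := aux_low hA hφ hD x hm h0 h1 h
      have hmono : ∫ t in Set.Ioc r₁ (2 * r₁), φ x t / t ≤
          ∫ t in Set.Ioc r₁ (2 * r₂), φ x t / t := by
        refine setIntegral_mono_set hI ?_
          (Set.Ioc_subset_Ioc_right (by linarith)).eventuallyLE
        refine (ae_restrict_mem measurableSet_Ioc).mono fun t ht => ?_
        have ht0 : 0 < t := h0.trans ht.1
        have := hφ x t ht0
        simp only [Pi.zero_apply]
        positivity
      calc _ ≤ _ := hs
        _ ≤ 2 ^ n * ((2 * A * ∫ t in Set.Ioc r₁ (2 * r₂), φ x t / t) * N) := by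
          gcongr
          exact hl.trans (by gcongr)
        _ = _ := by ring
    · obtain ⟨hi2, hb⟩ := ih (2 * r₁) (by linarith) h (by rw [pow_succ] at h2; linarith)
      have hun := Set.Ioc_union_Ioc_eq_Ioc (by linarith : r₁ ≤ 2 * r₁)
        (by linarith : 2 * r₁ ≤ 2 * r₂)
      refine ⟨by rw [← hun]; exact hi1.union hi2, ?_⟩
      have hs := aux_step hp hφ hf hfin x h0 (by linarith : r₁ ≤ 2 * r₁) le_rfl
      have hl := aux_low hA hφ hD x hm h0 (by linarith : r₁ ≤ 2 * r₁) le_rfl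
      rw [← hun, setIntegral_union (Set.Ioc_disjoint_Ioc_of_le le_rfl) measurableSet_Ioc hi1 hi2]
      have hs2 : |ballAvg f x r₁ - ballAvg f x (2 * r₁)| ≤
          2 ^ n * ((2 * A * ∫ t in Set.Ioc r₁ (2 * r₁), φ x t / t) * N) := by
        refine hs.trans ?_
        gcongr
      have := abs_sub_le (ballAvg f x r₁) (ballAvg f x (2 * r₁)) (ballAvg f x r₂)
      nlinarith [this, hs2, hb]

/-- If `φ` satisfies (D) with constant `A₁`, then
`|f_{B(x,r₁)} − f_{B(x,r₂)}| ≤ C (∫_{r₁}^{2r₂} φ(x,t)/t dt) ‖f‖_{𝓛_{p,φ}}` for `0 < r₁ < r₂`,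
with `C` depending only on `n` and `A₁`. -/
theorem ball_average_difference_bound (n : ℕ) (A₁ : ℝ) (hA₁ : 0 < A₁) :
    ∃ C > 0, ∀ (p : ℝ), 1 ≤ p →
      ∀ (φ : EuclideanSpace ℝ (Fin n) → ℝ → ℝ), GrowthPos φ → DoublingWith A₁ φ →
      (∀ x : EuclideanSpace ℝ (Fin n), Measurable fun t => φ x t) →
      ∀ f : EuclideanSpace ℝ (Fin n) → ℝ, MemLpLoc p f → campSemi p φ f < ⊤ →
      ∀ (x : EuclideanSpace ℝ (Fin n)) (r₁ r₂ : ℝ), 0 < r₁ → r₁ < r₂ →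
        ENNReal.ofReal |ballAvg f x r₁ - ballAvg f x r₂| ≤
          ENNReal.ofReal (C * ∫ t in Set.Ioc r₁ (2 * r₂), φ x t / t) * campSemi p φ f := by
  refine ⟨2 ^ n * (2 * A₁), by positivity, ?_⟩
  intro p hp φ hφ hD hm f hf hfin x r₁ r₂ h0 h12
  obtain ⟨k, hk⟩ := pow_unbounded_of_one_lt (r₂ / r₁) (by norm_num : (1 : ℝ) < 2)
  rw [div_lt_iff₀ h0] at hk
  have h := (aux_main hA₁ hp hφ hD hf hfin x (hm x) r₂ k r₁ h0 h12.le hk.le).2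
  have hi : 0 ≤ ∫ t in Set.Ioc r₁ (2 * r₂), φ x t / t := by
    refine setIntegral_nonneg measurableSet_Ioc fun t ht => ?_
    have ht0 : 0 < t := h0.trans ht.1
    have := hφ x t ht0
    positivity
  rw [← ENNReal.ofReal_toReal hfin.ne, ← ENNReal.ofReal_mul (by positivity)]
  exact ENNReal.ofReal_le_ofReal h

end
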